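/- arXiv:math/9211206 — 4 statements merged into one kernel-verified Lean document; each statement's English description precedes it below -/
import Mathlib

section
/- If E ⊆ ℝ and the set E' = {(x,y) : x + y ∈ E} lies in the σ-algebra generated by rectangles A × B with both A and B Lebesgue measurable, then E is analytic. -/
open MeasureTheory Set

/-- A null-measurable set becomes measurable after removing a suitable measurable null set. -/
theorem exists_measurable_null_inter_compl {α : Type*} [MeasurableSpace α] {μ : Measure α}
    {A : Set α} (hA : NullMeasurableSet A μ) :
    ∃ N, MeasurableSet N ∧ μ N = 0 ∧ MeasurableSet (A ∩ Nᶜ) := by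
  obtain ⟨A', hA', hAA'⟩ := hA
  obtain ⟨N, hsub, hN, hN0⟩ := exists_measurable_superset_of_null (ae_iff.mp hAA'.mem_iff)
  refine ⟨N, hN, hN0, ?_⟩
  have h : A ∩ Nᶜ = A' ∩ Nᶜ := by
    ext x
    refine and_congr_left fun hx => ?_
    by_contra hne
    exact hx (hsub hne)
  rw [h]
  exact hA'.inter hN.compl

/-- A set in the product of the completed `σ`-algebras becomes measurable after restricting
both coordinates to the complement of a suitable measurable null set. -/
theorem exists_measurable_null_inter_prod {α : Type*} [MeasurableSpace α] {μ : Measure α}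
    {S : Set (α × α)}
    (hS : MeasurableSet[MeasurableSpace.generateFrom
      {R : Set (α × α) | ∃ (A B : Set α),
        NullMeasurableSet A μ ∧ NullMeasurableSet B μ ∧ R = A ×ˢ B}] S) :
    ∃ N, MeasurableSet N ∧ μ N = 0 ∧ MeasurableSet (S ∩ Nᶜ ×ˢ Nᶜ) := by
  induction S, hS using MeasurableSpace.generateFrom_induction with
  | hC R hR _ =>
    obtain ⟨A, B, hA, hB, rfl⟩ := hR
    obtain ⟨M, hM, hM0, hAM⟩ := exists_measurable_null_inter_compl hA
    obtain ⟨N, hN, hN0, hBN⟩ := exists_measurable_null_inter_compl hB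
    refine ⟨M ∪ N, hM.union hN, measure_union_null hM0 hN0, ?_⟩
    rw [prod_inter_prod, compl_union, ← inter_assoc, inter_comm Mᶜ Nᶜ, ← inter_assoc]
    exact (hAM.inter hN.compl).prod (hBN.inter hM.compl)
  | empty => exact ⟨∅, MeasurableSet.empty, measure_empty, by simp⟩
  | compl S _ ih =>
    obtain ⟨N, hN, hN0, hSN⟩ := ih
    refine ⟨N, hN, hN0, ?_⟩
    have h : Sᶜ ∩ Nᶜ ×ˢ Nᶜ = (Nᶜ ×ˢ Nᶜ) \ (S ∩ Nᶜ ×ˢ Nᶜ) := by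
      rw [sdiff_inter_self_eq_sdiff, sdiff_eq, inter_comm]
    rw [h]
    exact (hN.compl.prod hN.compl).diff hSN
  | iUnion S _ ih =>
    choose N hN hN0 hSN using ih
    refine ⟨⋃ i, N i, MeasurableSet.iUnion hN, measure_iUnion_null hN0, ?_⟩
    have hU : MeasurableSet (⋃ i, N i)ᶜ := (MeasurableSet.iUnion hN).compl
    rw [iUnion_inter]
    refine MeasurableSet.iUnion fun i => ?_
    have hsub : (⋃ i, N i)ᶜ ⊆ (N i)ᶜ := compl_subset_compl.mpr (subset_iUnion N i)
    rw [← inter_eq_right.mpr (prod_mono hsub hsub), ← inter_assoc]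
    exact (hSN i).inter (hU.prod hU)

/-- Every real is a sum of two reals outside a given null set. -/
theorem exists_notMem_sub_notMem_of_null {N : Set ℝ} (hN : volume N = 0) (z : ℝ) :
    ∃ x, x ∉ N ∧ z - x ∉ N := by
  have h₁ : ∀ᵐ x : ℝ, x ∉ N := measure_eq_zero_iff_ae_notMem.mp hN
  have h₂ : ∀ᵐ x : ℝ, z - x ∉ N :=
    (Measure.measurePreserving_sub_left volume z).quasiMeasurePreserving.ae h₁
  exact (h₁.and h₂).exists

theorem stmt_4 (E : Set ℝ)
    (hE : MeasurableSet[MeasurableSpace.generateFrom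
      {R : Set (ℝ × ℝ) | ∃ (A B : Set ℝ),
        NullMeasurableSet A (volume : Measure ℝ) ∧
        NullMeasurableSet B (volume : Measure ℝ) ∧ R = A ×ˢ B}]
      {p : ℝ × ℝ | p.1 + p.2 ∈ E}) :
    AnalyticSet E := by
  obtain ⟨N, -, hN0, hmeas⟩ := exists_measurable_null_inter_prod hE
  have himage : (fun p : ℝ × ℝ => p.1 + p.2) ''
      ({p : ℝ × ℝ | p.1 + p.2 ∈ E} ∩ Nᶜ ×ˢ Nᶜ) = E := by
    ext z
    constructor
    · rintro ⟨p, ⟨hp, -⟩, rfl⟩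
      exact hp
    · intro hz
      obtain ⟨x, hx, hzx⟩ := exists_notMem_sub_notMem_of_null hN0 z
      have hsum : x + (z - x) = z := add_sub_cancel x z
      exact ⟨(x, z - x), ⟨by simpa [hsum] using hz, hx, hzx⟩, hsum⟩
  rw [← himage]
  exact hmeas.analyticSet.image_of_continuous (continuous_fst.add continuous_snd)
end

section
/- There exists an analytic set E ⊆ ℝ such that for every Lebesgue measure zero set Z ⊆ ℝ there exists x ∈ ℝ such that E \ (x + Z) is not Borel. -/
open MeasureTheory Set Pointwise

open Filter Topology

instance : PolishSpace Bool := inferInstance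

/-- There is an analytic subset of the Cantor space that is not Borel. -/
theorem exists_analyticSet_not_measurableSet :
    ∃ A : Set (ℕ → Bool), AnalyticSet A ∧ ¬ MeasurableSet A := by
  let X := (ℕ → Bool) × (ℕ → ℕ)
  obtain ⟨B, hBc, -, hB⟩ := TopologicalSpace.exists_countable_basis X
  obtain ⟨b, hb⟩ := hBc.exists_eq_range (by
    rw [nonempty_iff_ne_empty]
    rintro rfl
    exact empty_ne_univ (sUnion_empty.symm.trans hB.sUnion_eq))
  let K : Set X := {p | ∀ n, p.1 n = true → p ∉ b n}
  have hK : IsClosed K := by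
    have hKeq : K = ⋂ n, ({p : X | p.1 n = true}ᶜ ∪ (b n)ᶜ) := by
      ext p
      simp [K, imp_iff_not_or]
    rw [hKeq]
    refine isClosed_iInter fun n => IsClosed.union ?_ ?_
    · rw [isClosed_compl_iff]
      have hn : Continuous fun p : X => p.1 n := (continuous_apply n).comp continuous_fst
      exact (isOpen_discrete ({true} : Set Bool)).preimage hn
    · rw [isClosed_compl_iff]
      exact hB.isOpen (hb ▸ mem_range_self n)
  refine ⟨Prod.fst '' K, hK.analyticSet.image_of_continuous continuous_fst, fun hm => ?_⟩
  obtain ⟨F, hF, hFeq⟩ : ∃ F : Set X, IsClosed F ∧ Prod.fst '' F = (Prod.fst '' K)ᶜ := by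
    have hc := hm.compl.analyticSet
    rw [AnalyticSet] at hc
    rcases hc with hc | ⟨g, hg, hgr⟩
    · exact ⟨∅, isClosed_empty, by simp [hc]⟩
    · refine ⟨{p | p.1 = g p.2}, isClosed_eq continuous_fst (hg.comp continuous_snd), ?_⟩
      rw [← hgr]
      ext c
      exact ⟨fun ⟨p, hp, hpc⟩ => ⟨p.2, hp.symm.trans hpc⟩, fun ⟨w, hw⟩ => ⟨(c, w), hw.symm, rfl⟩⟩
  classical
  let c : ℕ → Bool := fun n => decide (b n ⊆ Fᶜ)
  have hcF : ∀ p : X, (∀ n, c n = true → p ∉ b n) ↔ p ∈ F := by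
    intro p
    constructor
    · intro h
      by_contra hp
      obtain ⟨v, hv, hpv, hvF⟩ := hB.exists_subset_of_mem_open (show p ∈ Fᶜ from hp) hF.isOpen_compl
      rw [hb] at hv
      obtain ⟨n, rfl⟩ := hv
      exact h n (by simpa [c] using hvF) hpv
    · intro hp n hn hpn
      have hn' : b n ⊆ Fᶜ := by simpa [c] using hn
      exact hn' hpn hp
  have hiff : c ∈ Prod.fst '' K ↔ c ∈ Prod.fst '' F := by
    constructor
    · rintro ⟨⟨c', w⟩, hp, rfl⟩
      exact ⟨_, (hcF _).1 hp, rfl⟩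
    · rintro ⟨p, hp, hpc⟩
      refine ⟨p, fun n hn => (hcF p).2 hp n ?_, hpc⟩
      rwa [← hpc]
  rw [hFeq] at hiff
  exact iff_not_self hiff

namespace SparseSum

/-- The positions of the nonzero decimal digits, with gaps prescribed by `f`. -/
def pos (f : ℕ → ℕ) (i : ℕ) : ℕ := ∑ j ∈ Finset.range (i + 1), (f j + 1)

/-- The nonzero decimal digit that codes a bit. -/
noncomputable def digit (b : Bool) : ℝ := if b then 2 else 1

/-- The `i`-th nonzero term of the decimal expansion coding `(f, ε)`. -/
noncomputable def term (f : ℕ → ℕ) (ε : ℕ → Bool) (i : ℕ) : ℝ :=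
  digit (ε i) * (1 / 10) ^ pos f i

/-- The real number whose `i`-th nonzero decimal digit codes `ε i` and is preceded by `f i`
zeros. -/
noncomputable def code (p : (ℕ → ℕ) × (ℕ → Bool)) : ℝ := ∑' i, term p.1 p.2 i

theorem one_le_digit (b : Bool) : 1 ≤ digit b := by
  cases b <;> norm_num [digit]

theorem digit_le_two (b : Bool) : digit b ≤ 2 := by
  cases b <;> norm_num [digit]

theorem lt_pos (f : ℕ → ℕ) (i : ℕ) : i + 1 ≤ pos f i := by
  calc i + 1 = ∑ _j ∈ Finset.range (i + 1), 1 := by simp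
    _ ≤ _ := Finset.sum_le_sum fun j _ => by omega

theorem pos_zero (f : ℕ → ℕ) : pos f 0 = f 0 + 1 := by simp [pos]

theorem pos_succ (f : ℕ → ℕ) (i : ℕ) :
    pos f (i + 1) = (f 0 + 1) + pos (fun j => f (j + 1)) i := by
  rw [pos, Finset.sum_range_succ', add_comm]
  rfl

theorem term_pos (f : ℕ → ℕ) (ε : ℕ → Bool) (i : ℕ) : 0 < term f ε i :=
  mul_pos (by linarith [one_le_digit (ε i)]) (by positivity)

theorem term_le (f : ℕ → ℕ) (ε : ℕ → Bool) (i : ℕ) : term f ε i ≤ 1 / 5 * (1 / 10) ^ i := by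
  calc term f ε i ≤ 2 * (1 / 10) ^ (i + 1) :=
        mul_le_mul (digit_le_two _)
          (pow_le_pow_of_le_one (by norm_num) (by norm_num) (lt_pos f i)) (by positivity)
          (by norm_num)
    _ = _ := by ring

theorem summable_bound : Summable fun i : ℕ => (1 / 5 : ℝ) * (1 / 10) ^ i :=
  (summable_geometric_of_lt_one (by norm_num) (by norm_num)).mul_left _

theorem summable_term (f : ℕ → ℕ) (ε : ℕ → Bool) : Summable (term f ε) :=
  summable_bound.of_nonneg_of_le (fun i => (term_pos f ε i).le) (term_le f ε)

theorem code_pos (p : (ℕ → ℕ) × (ℕ → Bool)) : 0 < code p :=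
  (summable_term p.1 p.2).tsum_pos (fun i => (term_pos _ _ i).le) 0 (term_pos _ _ 0)

theorem code_le (p : (ℕ → ℕ) × (ℕ → Bool)) : code p ≤ 2 / 9 := by
  calc code p ≤ ∑' i : ℕ, (1 / 5 : ℝ) * (1 / 10) ^ i :=
        (summable_term p.1 p.2).tsum_le_tsum (term_le p.1 p.2) summable_bound
    _ = 2 / 9 := by
        rw [tsum_mul_left, tsum_geometric_of_lt_one (by norm_num) (by norm_num)]
        norm_num

theorem code_eq (f : ℕ → ℕ) (ε : ℕ → Bool) :
    code (f, ε) = (1 / 10) ^ (f 0 + 1) *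
      (digit (ε 0) + code (fun i => f (i + 1), fun i => ε (i + 1))) := by
  rw [code, (summable_term f ε).tsum_eq_zero_add, mul_add, code, ← tsum_mul_left]
  congr 1
  · rw [term, pos_zero, mul_comm]
  · refine tsum_congr fun i => ?_
    simp only [term, pos_succ, pow_add]
    ring

theorem continuous_code : Continuous code := by
  refine continuous_tsum (fun i => ?_) summable_bound fun i p => ?_
  · refine Continuous.mul ?_ ?_
    · have hi : Continuous fun p : (ℕ → ℕ) × (ℕ → Bool) => p.2 i :=
        (continuous_apply i).comp continuous_snd
      exact (continuous_of_discreteTopology (f := digit)).comp hi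
    · refine (continuous_of_discreteTopology (f := fun n : ℕ => (1 / 10 : ℝ) ^ n)).comp ?_
      refine continuous_finsetSum _ fun j _ => ?_
      have hj : Continuous fun p : (ℕ → ℕ) × (ℕ → Bool) => p.1 j :=
        (continuous_apply j).comp continuous_fst
      exact hj.add continuous_const
  · rw [Real.norm_of_nonneg (term_pos _ _ i).le]
    exact term_le _ _ i

theorem le_of_code_eq {f g : ℕ → ℕ} {ε δ : ℕ → Bool} (h : code (f, ε) = code (g, δ)) :
    g 0 ≤ f 0 := by
  by_contra! hlt
  rw [code_eq f, code_eq g] at h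
  have h1 := one_le_digit (ε 0)
  have h2 := digit_le_two (δ 0)
  have h3 := code_pos (fun i => f (i + 1), fun i => ε (i + 1))
  have h4 := code_le (fun i => g (i + 1), fun i => δ (i + 1))
  have h5 : (1 / 10 : ℝ) ^ (g 0 + 1) ≤ (1 / 10) ^ (f 0 + 1 + 1) :=
    pow_le_pow_of_le_one (by norm_num) (by norm_num) (by omega)
  have h6 : (0 : ℝ) < (1 / 10) ^ (f 0 + 1) := by positivity
  have h7 : (0 : ℝ) < (1 / 10) ^ (g 0 + 1) := by positivity
  rw [pow_succ _ (f 0 + 1)] at h5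
  nlinarith

theorem head_tail_of_code_eq {f g : ℕ → ℕ} {ε δ : ℕ → Bool} (h : code (f, ε) = code (g, δ)) :
    f 0 = g 0 ∧ ε 0 = δ 0 ∧ code (fun i => f (i + 1), fun i => ε (i + 1)) =
      code (fun i => g (i + 1), fun i => δ (i + 1)) := by
  have hfg : f 0 = g 0 := le_antisymm (le_of_code_eq h.symm) (le_of_code_eq h)
  rw [code_eq f, code_eq g, hfg] at h
  have h' := mul_left_cancel₀ (by positivity) h
  have h1 := code_pos (fun i => f (i + 1), fun i => ε (i + 1))
  have h2 := code_le (fun i => f (i + 1), fun i => ε (i + 1))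
  have h3 := code_pos (fun i => g (i + 1), fun i => δ (i + 1))
  have h4 := code_le (fun i => g (i + 1), fun i => δ (i + 1))
  have hd : ε 0 = δ 0 := by
    generalize ε 0 = a at *
    generalize δ 0 = b at *
    cases a <;> cases b <;> simp [digit] at h' ⊢ <;> linarith
  refine ⟨hfg, hd, ?_⟩
  rw [hd] at h'
  exact add_left_cancel h'

theorem code_injective : Function.Injective code := by
  have key : ∀ (i : ℕ) (f g : ℕ → ℕ) (ε δ : ℕ → Bool), code (f, ε) = code (g, δ) →
      f i = g i ∧ ε i = δ i := by
    intro i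
    induction i with
    | zero => exact fun f g ε δ h => ⟨(head_tail_of_code_eq h).1, (head_tail_of_code_eq h).2.1⟩
    | succ i ih => exact fun f g ε δ h => ih _ _ _ _ (head_tail_of_code_eq h).2.2
  rintro ⟨f, ε⟩ ⟨g, δ⟩ h
  exact Prod.ext (funext fun i => (key i f g ε δ h).1) (funext fun i => (key i f g ε δ h).2)

/-- The union of `V` with its translates by `t` and `2 * t`. -/
def spread (V : Set ℝ) (t : ℝ) : Set ℝ :=
  V ∪ ((fun x => x - t) ⁻¹' V ∪ (fun x => x - 2 * t) ⁻¹' V)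

theorem isOpen_spread {V : Set ℝ} (hV : IsOpen V) (t : ℝ) : IsOpen (spread V t) :=
  hV.union ((hV.preimage (by fun_prop)).union (hV.preimage (by fun_prop)))

theorem add_digit_mul_mem_spread {V : Set ℝ} {x : ℝ} (hx : x ∈ V) (b : Bool) (t : ℝ) :
    x + digit b * t ∈ spread V t := by
  cases b
  · exact Or.inr (Or.inl (by simpa [digit] using hx))
  · exact Or.inr (Or.inr (by simpa [digit] using hx))

theorem tendsto_volume_translate_diff {V : Set ℝ} (hV : MeasurableSet V) (hfin : volume V ≠ ⊤)
    (a : ℝ) :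
    Tendsto (fun t : ℝ => volume ((fun x => x - a * t) ⁻¹' V \ V)) (𝓝 0) (𝓝 0) := by
  let F : C(ℝ × ℝ, ℝ) := ⟨fun p => p.2 - a * p.1, by fun_prop⟩
  have hF : Tendsto (fun t => F.curry t) (𝓝 0) (𝓝 (F.curry 0)) := F.curry.continuous.tendsto 0
  have hmp : ∀ t, MeasurePreserving (F.curry t) (volume : Measure ℝ) volume :=
    fun t => measurePreserving_sub_right volume (a * t)
  have h := tendsto_measure_symmDiff_preimage_nhds_zero hF (Eventually.of_forall hmp) (hmp 0)
    hV.nullMeasurableSet hfin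
  refine tendsto_of_tendsto_of_tendsto_of_le_of_le tendsto_const_nhds h (fun _ => zero_le)
    fun t => measure_mono ?_
  intro x hx
  refine Or.inl ⟨hx.1, ?_⟩
  simpa [F] using hx.2

theorem eventually_volume_spread_lt {V : Set ℝ} (hV : MeasurableSet V) (hlt : volume V < 1) :
    ∀ᶠ t in 𝓝 (0 : ℝ), volume (spread V t) < 1 := by
  have hfin : volume V ≠ ⊤ := (hlt.trans ENNReal.one_lt_top).ne
  have h := (tendsto_const_nhds (x := volume V)).add
    ((tendsto_volume_translate_diff hV hfin 1).add (tendsto_volume_translate_diff hV hfin 2))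
  simp only [add_zero, one_mul] at h
  filter_upwards [h.eventually_lt_const hlt] with t ht
  refine lt_of_le_of_lt ?_ ht
  calc volume (spread V t)
      = volume (V ∪ ((fun x => x - t) ⁻¹' V \ V ∪ (fun x => x - 2 * t) ⁻¹' V \ V)) := by
        rw [← union_sdiff_distrib, union_sdiff_self, spread]
    _ ≤ _ := (measure_union_le _ _).trans (by gcongr; exact measure_union_le _ _)

theorem exists_volume_spread_lt (V : Set ℝ) :
    ∃ N : ℕ, IsOpen V → volume V < 1 → ∀ n ≥ N, volume (spread V ((1 / 10) ^ n)) < 1 := by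
  by_cases h : IsOpen V ∧ volume V < 1
  · have hpow : Tendsto (fun n : ℕ => (1 / 10 : ℝ) ^ n) atTop (𝓝 0) :=
      tendsto_pow_atTop_nhds_zero_of_lt_one (by norm_num) (by norm_num)
    obtain ⟨N, hN⟩ := eventually_atTop.1
      (hpow.eventually (eventually_volume_spread_lt h.1.measurableSet h.2))
    exact ⟨N, fun _ _ => hN⟩
  · exact ⟨0, fun h1 h2 => (h ⟨h1, h2⟩).elim⟩

theorem exists_spread_seq {U : Set ℝ} (hU : IsOpen U) (hlt : volume U < 1) :
    ∃ (f : ℕ → ℕ) (V : ℕ → Set ℝ), V 0 = U ∧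
      (∀ k, V (k + 1) = spread (V k) ((1 / 10) ^ pos f k)) ∧ ∀ k, volume (V k) < 1 := by
  choose N hN using exists_volume_spread_lt
  let p : ℕ → Set ℝ × ℕ := fun k => k.rec (U, 0) fun _ q =>
    (spread q.1 ((1 / 10) ^ (q.2 + (N q.1 + 1))), q.2 + (N q.1 + 1))
  have hp : ∀ k, p (k + 1) = (spread (p k).1 ((1 / 10) ^ ((p k).2 + (N (p k).1 + 1))),
    (p k).2 + (N (p k).1 + 1)) := fun _ => rfl
  have hsum : ∀ k, (p k).2 = ∑ j ∈ Finset.range k, (N (p j).1 + 1) := by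
    intro k
    induction k with
    | zero => rfl
    | succ k ih => rw [Finset.sum_range_succ, ← ih, hp]
  have hV : ∀ k, IsOpen (p k).1 ∧ volume (p k).1 < 1 := by
    intro k
    induction k with
    | zero => exact ⟨hU, hlt⟩
    | succ k ih =>
      rw [hp]
      exact ⟨isOpen_spread ih.1 _, hN _ ih.1 ih.2 _ (by omega)⟩
  refine ⟨fun k => N (p k).1, fun k => (p k).1, rfl, fun k => ?_, fun k => (hV k).2⟩
  rw [pos, ← hsum, hp]

/-- For a null set `Z`, a sufficiently sparse set of codes misses some translate of `Z`. -/
theorem exists_code_notMem_vadd {Z : Set ℝ} (hZ : volume Z = 0) :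
    ∃ (f : ℕ → ℕ) (x : ℝ), ∀ ε, code (f, ε) ∉ x +ᵥ Z := by
  have hneg : volume (-Z) < 1 := by
    rw [Measure.measure_neg, hZ]
    exact one_pos
  obtain ⟨U, hZU, hU, hlt⟩ := (-Z).exists_isOpen_lt_of_lt 1 hneg
  obtain ⟨f, V, hV0, hVs, hVlt⟩ := exists_spread_seq hU hlt
  have hmono : Monotone V := monotone_nat_of_le_succ fun k => by
    rw [hVs]
    exact subset_union_left
  have hne : (⋃ k, V k) ≠ univ := by
    intro h
    have hle : volume (⋃ k, V k) ≤ 1 := by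
      rw [hmono.measure_iUnion]
      exact iSup_le fun k => (hVlt k).le
    rw [h, Real.volume_univ] at hle
    exact ENNReal.one_ne_top (top_le_iff.1 hle)
  obtain ⟨x, hx⟩ := (ne_univ_iff_exists_notMem _).1 hne
  refine ⟨f, x, fun ε hε => hx ?_⟩
  obtain ⟨z, hz, hzε⟩ := hε
  have hxz : x + z = code (f, ε) := hzε
  have hsplit : ∀ k, x = (-z + ∑' i, term f ε (i + k)) + ∑ i ∈ Finset.range k, term f ε i := by
    intro k
    have hk := (summable_term f ε).sum_add_tsum_nat_add k
    rw [code] at hxz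
    dsimp only at hxz
    linarith
  have htail : Tendsto (fun k => -z + ∑' i, term f ε (i + k)) atTop (𝓝 (-z)) := by
    simpa using (tendsto_sum_nat_add (term f ε)).const_add (-z)
  obtain ⟨k, hk⟩ := (htail.eventually (hU.mem_nhds (hZU (by simpa using hz)))).exists
  have hmem : ∀ m y, y ∈ U → y + ∑ i ∈ Finset.range m, term f ε i ∈ V m := by
    intro m y hy
    induction m with
    | zero => simpa [hV0] using hy
    | succ m ih =>
      rw [Finset.sum_range_succ, ← add_assoc, hVs]
      exact add_digit_mul_mem_spread ih _ _
  rw [hsplit k]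
  exact mem_iUnion.2 ⟨k, hmem k _ hk⟩

end SparseSum

open SparseSum in
theorem stmt_16 :
    ∃ E : Set ℝ, AnalyticSet E ∧
      ∀ Z : Set ℝ, (volume : Measure ℝ) Z = 0 →
        ∃ x : ℝ, ¬ MeasurableSet (E \ (x +ᵥ Z)) := by
  obtain ⟨A, hA, hAm⟩ := exists_analyticSet_not_measurableSet
  refine ⟨code '' (Prod.snd ⁻¹' A),
    (hA.preimage continuous_snd).image_of_continuous continuous_code, fun Z hZ => ?_⟩
  obtain ⟨f, x, hx⟩ := exists_code_notMem_vadd hZ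
  refine ⟨x, fun hm => hAm ?_⟩
  have hcont : Continuous fun ε : ℕ → Bool => code (f, ε) :=
    continuous_code.comp (by fun_prop)
  convert! hcont.measurable hm using 1
  ext ε
  rw [mem_preimage, Set.mem_sdiff, code_injective.mem_set_image]
  exact ⟨fun h => ⟨h, hx ε⟩, fun h => h.1⟩
end

section
/- There exists an analytic set E ⊆ ℝ such that E' = {(x,y) : x + y ∈ E} is not in the σ-algebra generated by rectangles A × B with A ⊆ ℝ arbitrary and B ⊆ ℝ Lebesgue measurable. -/
open MeasureTheory Set

theorem Cardinal.continuous_cantorFunction {c : ℝ} (h0 : 0 ≤ c) (h1 : c < 1) :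
    Continuous (Cardinal.cantorFunction c) := by
  refine continuous_tsum (u := fun n => c ^ n) (fun n => ?_)
    (summable_geometric_of_lt_one h0 h1) fun n f => ?_
  · exact (continuous_of_discreteTopology (f := fun b : Bool => cond b (c ^ n) 0)).comp
      (continuous_apply n)
  · have := pow_nonneg h0 n
    cases hf : f n <;> simp [Cardinal.cantorFunctionAux, hf, abs_of_nonneg, h0, this]

/-- Two Borel maps into the line whose ranges have a direct sum. -/
theorem exists_measurable_add_injective :
    ∃ (h : (ℕ → Bool) → ℝ) (k : ℝ → ℝ), Measurable h ∧ Measurable k ∧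
      ∀ c d c' d', h c + k d = h c' + k d' → c = c' ∧ d = d' := by
  let e : ℝ ≃ᵐ (ℕ → Bool) := PolishSpace.measurableEquivNatBoolOfNotCountable
    (by rw [not_countable_iff]; infer_instance)
  let l : (ℕ → Bool) → ℕ → Bool := fun c n => !n.bodd && c n.div2
  let r : (ℕ → Bool) → ℕ → Bool := fun c n => n.bodd && c n.div2
  let m : (ℕ → Bool) → (ℕ → Bool) → ℕ → Bool := fun c d n => cond n.bodd (d n.div2) (c n.div2)
  have hcont : Measurable (Cardinal.cantorFunction (1 / 3)) :=
    (Cardinal.continuous_cantorFunction (by norm_num) (by norm_num)).measurable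
  have hl : Measurable l := measurable_pi_lambda _ fun n =>
    (measurable_of_countable fun b => !n.bodd && b).comp (measurable_pi_apply _)
  have hr : Measurable r := measurable_pi_lambda _ fun n =>
    (measurable_of_countable fun b => n.bodd && b).comp (measurable_pi_apply _)
  have hadd : ∀ c d, Cardinal.cantorFunction (1 / 3) (l c) + Cardinal.cantorFunction (1 / 3) (r d)
      = Cardinal.cantorFunction (1 / 3) (m c d) := by
    intro c d
    unfold Cardinal.cantorFunction
    rw [← (Cardinal.summable_cantor_function _ (by norm_num) (by norm_num)).tsum_add
      (Cardinal.summable_cantor_function _ (by norm_num) (by norm_num))]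
    congr 1
    ext n
    cases hn : n.bodd <;> simp [Cardinal.cantorFunctionAux, l, r, m, hn]
  refine ⟨fun c => Cardinal.cantorFunction (1 / 3) (l c),
    fun d => Cardinal.cantorFunction (1 / 3) (r (e d)), hcont.comp hl,
    hcont.comp (hr.comp e.measurable), fun c d c' d' heq => ?_⟩
  simp only [hadd] at heq
  have hm := Cardinal.cantorFunction_injective (by norm_num) (by norm_num) heq
  constructor
  · ext n
    simpa [m] using congrFun hm (Nat.bit false n)
  · apply e.injective
    ext n
    simpa [m] using congrFun hm (Nat.bit true n)

/-- A Borel set whose projections along Baire space run through all analytic sets. -/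
theorem exists_universal_analyticSet (α : Type*) [TopologicalSpace α] [SecondCountableTopology α]
    [T2Space α] [MeasurableSpace α] [BorelSpace α] :
    ∃ F : Set ((ℕ → Bool) × α × (ℕ → ℕ)), MeasurableSet F ∧
      ∀ S : Set α, AnalyticSet S → ∃ c, ∀ d, d ∈ S ↔ ∃ w, (c, d, w) ∈ F := by
  obtain ⟨b, hbc, -, hb⟩ := TopologicalSpace.exists_countable_basis (α × (ℕ → ℕ))
  obtain ⟨f, hf⟩ := (hbc.union (countable_singleton ∅)).exists_eq_range ⟨∅, by simp⟩
  have hfo : ∀ n, IsOpen (f n) := by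
    intro n
    have : f n ∈ b ∪ {∅} := hf ▸ mem_range_self n
    rcases this with h | h
    · exact hb.isOpen h
    · rw [mem_singleton_iff.1 h]; exact isOpen_empty
  refine ⟨⋂ n, {p | p.1 n = true → p.2 ∉ f n}, ?_, fun S hS => ?_⟩
  · refine MeasurableSet.iInter fun n => MeasurableSet.imp ?_ ?_
    · exact (measurableSet_singleton true).preimage ((measurable_pi_apply n).comp measurable_fst)
    · exact ((hfo n).measurableSet.preimage measurable_snd).compl
  · obtain ⟨C, hC, hCS⟩ : ∃ C : Set (α × (ℕ → ℕ)), IsClosed C ∧ ∀ d, d ∈ S ↔ ∃ w, (d, w) ∈ C := by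
      rw [AnalyticSet] at hS
      rcases hS with rfl | ⟨g, hg, rfl⟩
      · exact ⟨∅, isClosed_empty, by simp⟩
      · exact ⟨{p | g p.2 = p.1}, isClosed_eq (hg.comp continuous_snd) continuous_fst, by simp⟩
    classical
    refine ⟨fun n => decide (Disjoint (f n) C), fun d => ?_⟩
    rw [hCS]
    refine exists_congr fun w => ?_
    simp only [mem_iInter, mem_ofPred_eq, decide_eq_true_eq]
    constructor
    · exact fun h n hn hmem => disjoint_left.1 hn hmem h
    · intro h
      by_contra hw
      obtain ⟨v, hv, hwv, hvC⟩ := hb.exists_subset_of_mem_open (mem_compl hw) hC.isOpen_compl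
      obtain ⟨n, rfl⟩ : v ∈ range f := hf ▸ Or.inl hv
      exact h n (disjoint_left.2 fun _ hx => hvC hx) hwv

/-- Up to a null set of ordinates, a set in the σ-algebra generated by rectangles with one null
measurable side is a pullback of a Borel set under a map acting on abscissas only. -/
theorem exists_measurable_reduction {α β : Type*} [MeasurableSpace β] {μ : Measure β}
    {G : Set (α × β)}
    (hG : MeasurableSet[MeasurableSpace.generateFrom
        {R : Set (α × β) | ∃ (A : Set α) (B : Set β), NullMeasurableSet B μ ∧ R = A ×ˢ B}] G) :
    ∃ (a : α → ℕ → Bool) (W : Set ((ℕ → Bool) × β)), MeasurableSet W ∧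
      ∀ᵐ y ∂μ, ∀ x, (x, y) ∈ G ↔ (a x, y) ∈ W := by
  classical
  induction G, hG using MeasurableSpace.generateFrom_induction with
  | hC R hR _ =>
    obtain ⟨A, B, hB, rfl⟩ := hR
    obtain ⟨B', hB', hBB'⟩ := hB
    refine ⟨fun x _ => decide (x ∈ A), ((fun u => u 0) ⁻¹' {true}) ×ˢ B',
      ((measurableSet_singleton true).preimage (measurable_pi_apply 0)).prod hB', ?_⟩
    filter_upwards [hBB'.mem_iff] with y hy x
    simp [hy]
  | empty => exact ⟨fun _ _ => true, ∅, .empty, by simp⟩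
  | compl t _ ih =>
    obtain ⟨a, W, hW, h⟩ := ih
    refine ⟨a, Wᶜ, hW.compl, ?_⟩
    filter_upwards [h] with y hy x
    simp [hy]
  | iUnion s _ ih =>
    choose a W hW h using ih
    refine ⟨fun x n => a n.unpair.1 x n.unpair.2,
      ⋃ n, (fun p => (fun m => p.1 (Nat.pair n m), p.2)) ⁻¹' W n,
      MeasurableSet.iUnion fun n => (hW n).preimage ?_, ?_⟩
    · exact (measurable_pi_lambda _ fun m =>
        (measurable_pi_apply _).comp measurable_fst).prodMk measurable_snd
    · filter_upwards [ae_all_iff.2 h] with y hy x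
      simp [hy]

/-- Some translate of a Borel map of the line into itself sends an injective Borel image of Cantor
space into a given conull set. -/
theorem exists_translate_injective_mem {p : ℝ → Prop} (hp : ∀ᵐ y, p y)
    {k : ℝ → ℝ} (hk : Measurable k) :
    ∃ (t : ℝ) (g : (ℕ → Bool) → ℝ), Measurable g ∧ Function.Injective g ∧
      ∀ u, p (k (g u) + t) := by
  obtain ⟨Q, hQ, hQm, hQp⟩ := hp.exists_measurable_mem
  have hms : MeasurableSet {q : ℝ × ℝ | k q.2 + q.1 ∈ Q} :=
    hQm.preimage ((hk.comp measurable_snd).add measurable_fst)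
  have hswap : ∀ᵐ t : ℝ, ∀ᵐ d : ℝ, k d + t ∈ Q := by
    refine (Measure.ae_ae_comm hms).2 (ae_of_all _ fun d => ?_)
    exact (measurePreserving_add_left volume (k d)).quasiMeasurePreserving.ae hQ
  obtain ⟨t, ht⟩ := hswap.exists
  have hTm : MeasurableSet {d | k d + t ∈ Q} := hQm.preimage (hk.add_const t)
  have hT : ¬ Countable {d | k d + t ∈ Q} := by
    intro hcount
    have h1 : ∀ᵐ d : ℝ, d ∉ {d | k d + t ∈ Q} := (Set.to_countable _).ae_notMem volume
    obtain ⟨d, hd, hd'⟩ := (ht.and h1).exists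
    exact hd' hd
  have := hTm.standardBorel
  let g : (ℕ → Bool) ≃ᵐ {d | k d + t ∈ Q} :=
    (PolishSpace.measurableEquivNatBoolOfNotCountable hT).symm
  exact ⟨t, fun u => g u, measurable_subtype_coe.comp g.measurable,
    Subtype.val_injective.comp g.injective, fun u => hQp _ (g u).2⟩

theorem stmt_17 :
    ∃ E : Set ℝ, AnalyticSet E ∧
      ¬ MeasurableSet[MeasurableSpace.generateFrom
        {R : Set (ℝ × ℝ) | ∃ (A B : Set ℝ),
          NullMeasurableSet B (volume : Measure ℝ) ∧ R = A ×ˢ B}]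
        {p : ℝ × ℝ | p.1 + p.2 ∈ E} := by
  obtain ⟨h, k, hh, hk, hinj⟩ := exists_measurable_add_injective
  obtain ⟨F, hF, hFS⟩ := exists_universal_analyticSet ℝ
  refine ⟨(fun p : (ℕ → Bool) × ℝ × (ℕ → ℕ) => h p.1 + k p.2.1) '' F,
    hF.analyticSet_image (by fun_prop), fun hE => ?_⟩
  obtain ⟨a, W, hW, hae⟩ := exists_measurable_reduction hE
  obtain ⟨t, g, hg, hginj, hgt⟩ := exists_translate_injective_mem hae hk
  have hS : MeasurableSet {u | (u, k (g u) + t) ∉ W} :=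
    (hW.preimage (measurable_id.prodMk ((hk.comp hg).add_const t))).compl
  obtain ⟨c, hc⟩ := hFS _ (hS.analyticSet_image hg)
  have key := hgt (a (h c - t)) (h c - t)
  have hsum : h c - t + (k (g (a (h c - t))) + t) = h c + k (g (a (h c - t))) := by ring
  have hdiag := hc (g (a (h c - t)))
  rw [hginj.mem_set_image, mem_ofPred_eq] at hdiag
  rw [mem_ofPred_eq, hsum] at key
  have hmem : h c + k (g (a (h c - t))) ∈
      (fun p : (ℕ → Bool) × ℝ × (ℕ → ℕ) => h p.1 + k p.2.1) '' F ↔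
      ∃ w, (c, g (a (h c - t)), w) ∈ F := by
    constructor
    · rintro ⟨⟨c', d', w⟩, hw, heq⟩
      obtain ⟨hc', hd'⟩ := hinj _ _ _ _ heq
      exact ⟨w, by rwa [← hd', ← hc']⟩
    · rintro ⟨w, hw⟩
      exact ⟨_, hw, rfl⟩
  tauto
end

section
/- There exists an analytic set E ⊆ ℝ such that E' = {(x,y) : x + y ∈ E} is not in the σ-algebra generated by rectangles A × B with A ⊆ ℝ arbitrary and B ⊆ ℝ having the property of Baire. -/
open MeasureTheory Set

/-- The Cantor space contains an analytic set that is not Borel. -/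
theorem exists_analyticSet_not_measurableSet_nat_bool :
    ∃ E : Set (ℕ → Bool), AnalyticSet E ∧ ¬ MeasurableSet E := by
  classical
  have : SecondCountableTopology (ℕ → Bool) := inferInstance
  have : TopologicalSpace.IsCompletelyMetrizableSpace (ℕ → Bool) := inferInstance
  have hbasis := TopologicalSpace.isBasis_countableBasis ((ℕ → Bool) × (ℕ → ℕ))
  have hne : (TopologicalSpace.countableBasis ((ℕ → Bool) × (ℕ → ℕ))).Nonempty := by
    by_contra h
    have := hbasis.sUnion_eq
    rw [Set.not_nonempty_iff_eq_empty.1 h, sUnion_empty] at this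
    exact empty_ne_univ this
  obtain ⟨B, hB⟩ := (TopologicalSpace.countable_countableBasis
    ((ℕ → Bool) × (ℕ → ℕ))).exists_eq_range hne
  rw [hB] at hbasis
  have hBo : ∀ n, IsOpen (B n) := fun n => hbasis.isOpen ⟨n, rfl⟩
  let F : Set ((ℕ → Bool) × (ℕ → ℕ)) := {q | ∀ n, q.1 n = true → q ∉ B n}
  have hF : IsClosed F := by
    have : F = ⋂ n, ({q | q.1 n = true} ∩ B n)ᶜ := by
      ext q; simp [F]
    rw [this]
    refine isClosed_iInter fun n => (IsOpen.inter ?_ (hBo n)).isClosed_compl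
    exact (isOpen_discrete ({true} : Set Bool)).preimage
      (show Continuous fun q : (ℕ → Bool) × (ℕ → ℕ) => q.1 n by fun_prop)
  refine ⟨Prod.fst '' F, hF.analyticSet.image_of_continuous continuous_fst, fun hmeas => ?_⟩
  have hcompl : AnalyticSet (Prod.fst '' F)ᶜ := hmeas.compl.analyticSet
  obtain ⟨H, hH, hHE⟩ : ∃ H : Set ((ℕ → Bool) × (ℕ → ℕ)),
      IsClosed H ∧ Prod.fst '' H = (Prod.fst '' F)ᶜ := by
    rw [AnalyticSet] at hcompl
    rcases hcompl with h | ⟨f, hf, hfr⟩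
    · exact ⟨∅, isClosed_empty, by rw [h, image_empty]⟩
    · refine ⟨{q | f q.2 = q.1}, isClosed_eq (hf.comp continuous_snd) continuous_fst, ?_⟩
      rw [← hfr]
      ext z
      simp
  let z : ℕ → Bool := fun n => decide (B n ⊆ Hᶜ)
  have hz : ∀ y, (z, y) ∈ F ↔ (z, y) ∈ H := by
    intro y
    constructor
    · intro h
      by_contra hnot
      obtain ⟨_, ⟨n, rfl⟩, hn, hsub⟩ :=
        hbasis.exists_subset_of_mem_open (show (z, y) ∈ Hᶜ from hnot) hH.isOpen_compl
      exact h n (by simpa [z] using hsub) hn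
    · intro h n hn hmem
      have hsub : B n ⊆ Hᶜ := by simpa [z] using hn
      exact hsub hmem h
  have key : z ∈ Prod.fst '' F ↔ z ∈ Prod.fst '' H := by
    simp [hz]
  rw [hHE] at key
  exact iff_not_self key

/-- The indicator function of the set `{2 * p k + a k | k : ℕ}`, for `p` strictly increasing. -/
def parityCode (q : (ℕ → ℕ) × (ℕ → Bool)) : ℕ → Bool :=
  fun i => decide (∃ k < i + 1, 2 * q.1 k + (q.2 k).toNat = i)

theorem continuous_parityCode : Continuous parityCode := by
  refine continuous_pi fun i => ?_
  let c : (ℕ → ℕ) × (ℕ → Bool) → (Fin (i + 1) → ℕ × Bool) := fun q k => (q.1 k, q.2 k)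
  have hc : Continuous c := by fun_prop
  let d : (Fin (i + 1) → ℕ × Bool) → Bool :=
    fun r => decide (∃ k, 2 * (r k).1 + (r k).2.toNat = i)
  have hd : Continuous d := continuous_of_discreteTopology
  refine (hd.comp hc).congr fun q => ?_
  simp only [Function.comp, d, c, parityCode, decide_eq_decide]
  exact ⟨fun ⟨k, hk⟩ => ⟨k, k.2, hk⟩, fun ⟨k, hk, h⟩ => ⟨⟨k, hk⟩, h⟩⟩

theorem parityCode_eq_true_iff {p : ℕ → ℕ} (hp : StrictMono p) (a : ℕ → Bool) (i : ℕ) :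
    parityCode (p, a) i = true ↔ ∃ k, 2 * p k + (a k).toNat = i := by
  simp only [parityCode, decide_eq_true_eq]
  refine ⟨fun ⟨k, _, h⟩ => ⟨k, h⟩, fun ⟨k, h⟩ => ⟨k, ?_, h⟩⟩
  have := hp.id_le k
  simp only [id] at this
  omega

theorem strictMono_two_mul_add_toNat {p : ℕ → ℕ} (hp : StrictMono p) (a : ℕ → Bool) :
    StrictMono fun k => 2 * p k + (a k).toNat := by
  intro j k hjk
  have h1 := hp hjk
  have h2 := (a j).toNat_le
  dsimp only
  omega

theorem snd_eq_of_parityCode_eq {p p' : ℕ → ℕ} (hp : StrictMono p) (hp' : StrictMono p')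
    {a a' : ℕ → Bool} (h : parityCode (p, a) = parityCode (p', a')) : a = a' := by
  have hr : range (fun k => 2 * p k + (a k).toNat) = range fun k => 2 * p' k + (a' k).toNat := by
    ext i
    simp only [mem_range]
    rw [← parityCode_eq_true_iff hp, h, parityCode_eq_true_iff hp']
  have heq := ((strictMono_two_mul_add_toNat hp a).range_inj
    (strictMono_two_mul_add_toNat hp' a')).1 hr
  funext k
  have hk : 2 * p k + (a k).toNat = 2 * p' k + (a' k).toNat := congrFun heq k
  cases hx : a k <;> cases hy : a' k <;> simp only [hx, hy, Bool.toNat_true, Bool.toNat_false] at hk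
  · rfl
  · omega
  · omega
  · rfl

/-- All vertical sections of a set in the `σ`-algebra generated by the rectangles `A ×ˢ B`, with
`B` having the property of Baire, become Borel on a common residual set. -/
theorem exists_residual_measurableSet_sections {α β : Type*} [TopologicalSpace β]
    [MeasurableSpace β] [BorelSpace β] [BaireSpace β] {S : Set (α × β)}
    (hS : MeasurableSet[MeasurableSpace.generateFrom
      {R : Set (α × β) | ∃ (A : Set α) (B : Set β), BaireMeasurableSet B ∧ R = A ×ˢ B}] S) :
    ∃ G : Set β, IsGδ G ∧ Dense G ∧ ∀ x, MeasurableSet (Prod.mk x ⁻¹' S ∩ G) := by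
  induction S, hS using MeasurableSpace.generateFrom_induction with
  | hC S hS _ =>
    obtain ⟨A, B, hB, rfl⟩ := hS
    obtain ⟨U, hU, hBU⟩ := hB.residualEq_isOpen
    obtain ⟨G, hG, hGδ, hGd⟩ := mem_residual.1 hBU
    refine ⟨G, hGδ, hGd, fun x => ?_⟩
    by_cases hx : x ∈ A
    · have : Prod.mk x ⁻¹' A ×ˢ B ∩ G = U ∩ G := by
        ext y
        simp only [mem_inter_iff, mem_preimage, mem_prod, hx, true_and, and_congr_left_iff]
        exact fun hy => iff_of_eq (hG hy)
      rw [this]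
      exact hU.measurableSet.inter hGδ.measurableSet
    · have : Prod.mk x ⁻¹' A ×ˢ B ∩ G = ∅ := by
        ext y
        simp [hx]
      rw [this]
      exact MeasurableSet.empty
  | empty => exact ⟨univ, .univ, dense_univ, fun x => by simp⟩
  | compl S _ ih =>
    obtain ⟨G, hGδ, hGd, h⟩ := ih
    refine ⟨G, hGδ, hGd, fun x => ?_⟩
    have : Prod.mk x ⁻¹' Sᶜ ∩ G = G \ (Prod.mk x ⁻¹' S ∩ G) := by
      ext y
      simp only [mem_inter_iff, mem_preimage, mem_compl_iff, mem_sdiff]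
      tauto
    rw [this]
    exact hGδ.measurableSet.diff (h x)
  | iUnion S _ ih =>
    choose G hGδ hGd h using ih
    refine ⟨⋂ n, G n, .iInter hGδ, dense_iInter_of_Gδ hGδ hGd, fun x => ?_⟩
    have : Prod.mk x ⁻¹' (⋃ n, S n) ∩ ⋂ n, G n =
        (⋃ n, Prod.mk x ⁻¹' S n ∩ G n) ∩ ⋂ n, G n := by
      ext y
      simp only [mem_inter_iff, mem_preimage, mem_iUnion, mem_iInter]
      exact ⟨fun ⟨⟨n, hn⟩, hG⟩ => ⟨⟨n, hn, hG n⟩, hG⟩, fun ⟨⟨n, hn, _⟩, hG⟩ => ⟨⟨n, hn⟩, hG⟩⟩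
    rw [this]
    exact (MeasurableSet.iUnion fun n => h n x).inter
      (MeasurableSet.iInter fun n => (hGδ n).measurableSet)

/-- Some translate of a dense `Gδ` set contains the images of all codes along a suitable strictly
increasing sequence. -/
theorem exists_strictMono_forall_parityCode_sub_mem {W : (ℕ → Bool) → ℝ} (hW : Continuous W)
    {G : Set ℝ} (hG : IsGδ G) (hGd : Dense G) :
    ∃ (x : ℝ) (p : ℕ → ℕ), StrictMono p ∧ ∀ a, W (parityCode (p, a)) - x ∈ G := by
  classical
  obtain ⟨D, hDo, rfl⟩ := hG.eq_iInter_nat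
  let χ : Finset ℕ → ℕ → Bool := fun S i => decide (i ∈ S)
  obtain ⟨x, hx⟩ : ∃ x, ∀ S, W (χ S) - x ∈ ⋂ n, D n := by
    have := dense_iInter_of_Gδ (f := fun S => (fun x => W (χ S) - x) ⁻¹' ⋂ n, D n)
      (fun S => hG.preimage (by fun_prop))
      (fun S => hGd.preimage (Homeomorph.subLeft (W (χ S))).isOpenMap)
    obtain ⟨x, hx⟩ := this.nonempty
    exact ⟨x, fun S => mem_iInter.1 hx S⟩
  have hN : ∀ k S, ∃ N, ∀ b, (∀ i < N, b i = χ S i) → W b - x ∈ D k := by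
    intro k S
    have ho : IsOpen {b | W b - x ∈ D k} := (hDo k).preimage (by fun_prop)
    obtain ⟨N, hN⟩ := PiNat.exists_disjoint_cylinder ho.isClosed_compl (x := χ S)
      (by simpa using mem_iInter.1 (hx S) k)
    refine ⟨N, fun b hb => ?_⟩
    by_contra hnot
    exact disjoint_left.1 hN (show b ∈ {b | W b - x ∈ D k}ᶜ from hnot)
      (PiNat.mem_cylinder_iff.2 hb)
  choose N hN using hN
  let p : ℕ → ℕ := fun k => Nat.rec 0
    (fun k m => max (m + 1) ((Finset.range (2 * m + 2)).powerset.sup (N k))) k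
  have hps : ∀ k, p (k + 1) =
      max (p k + 1) ((Finset.range (2 * p k + 2)).powerset.sup (N k)) := fun k => rfl
  have hp : StrictMono p := strictMono_nat_of_lt_succ fun k => by
    rw [hps]
    exact Nat.lt_of_succ_le (le_max_left _ _)
  refine ⟨x, p, hp, fun a => mem_iInter.2 fun k => ?_⟩
  let S := (Finset.range (2 * p k + 2)).filter fun i => parityCode (p, a) i = true
  refine hN k S _ fun i hi => ?_
  have hle : N k S ≤ p (k + 1) := by
    rw [hps]
    exact le_max_of_le_right (Finset.le_sup (f := N k)
      (Finset.mem_powerset.2 (Finset.filter_subset _ _)))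
  rw [Bool.eq_iff_iff]
  simp only [χ, S, decide_eq_true_eq, Finset.mem_filter, Finset.mem_range]
  refine ⟨fun h => ⟨?_, h⟩, fun h => h.2⟩
  obtain ⟨j, hj⟩ := (parityCode_eq_true_iff hp a i).1 h
  have h2 := (a j).toNat_le
  rcases le_or_gt j k with hjk | hjk
  · have := hp.monotone hjk
    omega
  · have := hp.monotone (Nat.succ_le_of_lt hjk)
    simp only [Nat.succ_eq_add_one] at this
    omega

theorem isClosed_setOf_strictMono_nat : IsClosed {p : ℕ → ℕ | StrictMono p} := by
  have : {p : ℕ → ℕ | StrictMono p} = ⋂ n, {p | p n + 1 ≤ p (n + 1)} := by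
    ext p
    simp only [mem_ofPred_eq, mem_iInter]
    exact ⟨fun h n => h (Nat.lt_succ_self n), fun h => strictMono_nat_of_lt_succ h⟩
  rw [this]
  exact isClosed_iInter fun n => isClosed_le (by fun_prop) (by fun_prop)

theorem stmt_18 :
    ∃ E : Set ℝ, AnalyticSet E ∧
      ¬ MeasurableSet[MeasurableSpace.generateFrom
        {R : Set (ℝ × ℝ) | ∃ (A B : Set ℝ),
          BaireMeasurableSet B ∧ R = A ×ˢ B}]
        {p : ℝ × ℝ | p.1 + p.2 ∈ E} := by
  obtain ⟨E₀, hE₀, hE₀m⟩ := exists_analyticSet_not_measurableSet_nat_bool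
  obtain ⟨W, -, hW, hWi⟩ :=
    (isClosed_univ (X := ℝ)).exists_nat_bool_injection_of_not_countable Cardinal.not_countable_real
  let Q : Set ((ℕ → ℕ) × (ℕ → Bool)) := {q | StrictMono q.1 ∧ q.2 ∈ E₀}
  have hQ : AnalyticSet Q := by
    obtain ⟨γ, _, _, f, hf, hfr⟩ := analyticSet_iff_exists_polishSpace_range.1 hE₀
    have hcl : IsClosed {q : (ℕ → ℕ) × γ | StrictMono q.1} :=
      isClosed_setOf_strictMono_nat.preimage continuous_fst
    have : Q = Prod.map id f '' {q : (ℕ → ℕ) × γ | StrictMono q.1} := by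
      ext ⟨p, a⟩
      simp only [Q, ← hfr, mem_ofPred_eq, mem_range, mem_image, Prod.exists, Prod.map_apply, id,
        Prod.mk.injEq]
      exact ⟨fun ⟨hp, y, hy⟩ => ⟨p, y, hp, rfl, hy⟩,
        fun ⟨_, y, hp, hpp, hy⟩ => ⟨hpp ▸ hp, y, hy⟩⟩
    rw [this]
    exact hcl.analyticSet.image_of_continuous (continuous_id.prodMap hf)
  refine ⟨(fun q => W (parityCode q)) '' Q,
    hQ.image_of_continuous (hW.comp continuous_parityCode), fun hmeas => hE₀m ?_⟩
  obtain ⟨G, hG, hGd, hsec⟩ := exists_residual_measurableSet_sections hmeas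
  obtain ⟨x, p, hp, hpG⟩ := exists_strictMono_forall_parityCode_sub_mem hW hG hGd
  have hcont : Continuous fun a => W (parityCode (p, a)) - x :=
    (hW.comp (continuous_parityCode.comp (by fun_prop))).sub continuous_const
  convert hcont.measurable (hsec x) using 1
  ext a
  simp only [mem_preimage, mem_inter_iff, mem_ofPred_eq, hpG, and_true, add_sub_cancel, mem_image]
  refine ⟨fun ha => ⟨(p, a), ⟨hp, ha⟩, rfl⟩, ?_⟩
  rintro ⟨⟨p', a'⟩, ⟨hp', ha'⟩, h⟩
  rwa [← snd_eq_of_parityCode_eq hp' hp (hWi h)]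
end
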